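/- Let r ≥ 1, δ ≥ 2 and n > r + δ − 1 be integers and let q be a prime power with q ≥ r + δ − 1. Suppose either (i) (r+δ−1) | n and N = n·r/(r+δ−1), or (ii) (r+δ−1) ∤ n, β₀ = (n mod (r+δ−1)) − (δ−1) ≥ 1, and N = n − (δ−1)·(⌊n/(r+δ−1)⌋ + 1). Let m ≥ N be an integer and let K be a finite field with |K| = q^m. Then for every integer 𝓜 with r ≤ 𝓜 ≤ N — and, in case (ii), additionally satisfying 0 < (𝓜 mod r) ≤ β₀ — there exists a scalar code C ⊆ K^n with |C| = (q^m)^𝓜 that has (r, δ) locality with α = 1 and whose minimum Hamming distance equals n − 𝓜 + 1 − (⌈𝓜/r⌉ − 1)·(δ − 1), attaining the bound d_min ≤ n − 𝓜 + 1 − (⌈𝓜/r⌉ − 1)(δ−1) for (r, δ) scalar locally repairable codes. -/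

import Mathlib

/-! Framework for (vector) codes of length `n` over an alphabet `A`:
codewords are functions `Fin n → A`, `puncture` restricts codewords to a subset of
coordinates, `minDist` is the minimum Hamming distance between distinct codewords, and
`HasLocality C r δ` is the `(r, δ)` locality property. -/

/-- The punctured code `C|_S`: restrictions of the codewords of `C` to `S`. -/
def puncture {n : ℕ} {A : Type*} (C : Set (Fin n → A)) (S : Finset (Fin n)) :
    Set (↥S → A) :=
  (fun c => fun i : ↥S => c i) '' C

/-- Minimum (Hamming) distance of a code: the least Hamming distance between two
distinct codewords. -/
noncomputable def minDist {n : ℕ} {A : Type*} [DecidableEq A] (C : Set (Fin n → A)) : ℕ :=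
  sInf {d | ∃ c ∈ C, ∃ c' ∈ C, c ≠ c' ∧ hammingDist c c' = d}

/-- `C` has `(r, δ)` locality: every coordinate `i` lies in a set `Γ` of at most
`r + δ - 1` coordinates such that the punctured code `C|_Γ` has minimum distance at
least `δ` (i.e. any two distinct restricted codewords are at Hamming distance ≥ δ). -/
def HasLocality {n : ℕ} {A : Type*} [DecidableEq A] (C : Set (Fin n → A)) (r δ : ℕ) :
    Prop :=
  ∀ i : Fin n, ∃ Γ : Finset (Fin n), i ∈ Γ ∧ Γ.card ≤ r + δ - 1 ∧
    ∀ u ∈ puncture C Γ, ∀ v ∈ puncture C Γ, u ≠ v → δ ≤ hammingDist u v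

open Finset

/-! ### Evaluation points split into groups -/

/-- The `j`-th evaluation point: the element of the span of the vectors `x ⟨g j, i⟩` attached to
the group `g j` of `j` whose coordinates are the powers of the node `α j`. -/
def groupPoint {F V G ι : Type*} [Field F] [AddCommGroup V] [Module F V] {D : G → ℕ}
    (g : ι → G) (α : ι → F) (x : (Σ h, Fin (D h)) → V) (j : ι) : V :=
  ∑ i : Fin (D (g j)), α j ^ (i : ℕ) • x ⟨g j, i⟩

section GroupPoint

variable {F V G ι : Type*} [Field F] [AddCommGroup V] [Module F V] {D : G → ℕ}
  {g : ι → G} {α : ι → F} {x : (Σ h, Fin (D h)) → V}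

/-- A linearly independent family can be mapped to prescribed scalars. -/
theorem LinearIndependent.exists_dual_apply_eq {κ : Type*} {z : κ → V}
    (hz : LinearIndependent F z) (a : κ → F) : ∃ φ : V →ₗ[F] F, ∀ k, φ (z k) = a k := by
  obtain ⟨s, hs⟩ := LinearMap.exists_leftInverse_of_injective (Finsupp.linearCombination F z)
    (LinearMap.ker_eq_bot.2 hz)
  refine ⟨Finsupp.linearCombination F a ∘ₗ s, fun k => ?_⟩
  have h := LinearMap.congr_fun hs (Finsupp.single k 1)
  simp only [LinearMap.comp_apply, Finsupp.linearCombination_single, one_smul,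
    LinearMap.id_apply] at h
  simp [h]

/-- Evaluation points are independent as long as no group contributes more points than its
dimension. -/
theorem linearIndepOn_groupPoint [DecidableEq G] (hx : LinearIndependent F x)
    (hα : ∀ i j, g i = g j → α i = α j → i = j) (T : Finset ι)
    (hT : ∀ h, #{j ∈ T | g j = h} ≤ D h) :
    LinearIndepOn F (groupPoint g α x) (T : Set ι) := by
  classical
  rw [linearIndepOn_finset_iff]
  intro c hc k hk
  set s : Finset ι := {j ∈ T | g j = g k} with hs
  have hinj : Set.InjOn α s := by
    intro i hi j hj hij
    simp only [hs, coe_filter, Set.mem_ofPred_eq] at hi hj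
    exact hα i j (hi.2.trans hj.2.symm) hij
  have hks : k ∈ s := by simp [hs, hk]
  set L := Lagrange.basis s α k
  have hdeg : L.natDegree < D (g k) := by
    have h1 : L.natDegree = #s - 1 := Lagrange.natDegree_basis hinj hks
    have h2 : 0 < #s := card_pos.2 ⟨k, hks⟩
    have h3 : #s ≤ D (g k) := hT (g k)
    omega
  obtain ⟨φ, hφ⟩ := hx.exists_dual_apply_eq fun h => if h.1 = g k then L.coeff h.2 else 0
  have hφy : ∀ j ∈ T, φ (groupPoint g α x j) = if j = k then 1 else 0 := by
    intro j hj
    simp only [groupPoint, map_sum, map_smul, hφ, smul_eq_mul]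
    by_cases hgj : g j = g k
    · have hjs : j ∈ s := by simp [hs, hj, hgj]
      have heval : ∑ i : Fin (D (g j)), α j ^ (i : ℕ) * L.coeff i = L.eval (α j) := by
        rw [Polynomial.eval_eq_sum_range' (hgj ▸ hdeg : L.natDegree < D (g j)),
          Fin.sum_univ_eq_sum_range (fun i => α j ^ i * L.coeff i)]
        exact sum_congr rfl fun i _ => mul_comm _ _
      simp only [hgj, if_true]
      rw [heval]
      split_ifs with hjk
      · rw [hjk]; exact Lagrange.eval_basis_self hinj hks
      · exact Lagrange.eval_basis_of_ne (Ne.symm hjk) hjs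
    · have hjk : j ≠ k := fun h => hgj (h ▸ rfl)
      simp [hgj, hjk]
  have h0 := congrArg φ hc
  rw [map_sum, map_zero, sum_congr rfl fun j hj => by rw [map_smul, hφy j hj]] at h0
  simpa [hk] using h0

/-- The points of a finite set on which a linear map vanishes span a subspace of its kernel whose
dimension is computed group by group. -/
theorem sum_min_card_le_finrank_ker [DecidableEq G] [Fintype G] {W : Type*} [AddCommGroup W] [Module F W]
    [FiniteDimensional F V] (hx : LinearIndependent F x)
    (hα : ∀ i j, g i = g j → α i = α j → i = j) (f : V →ₗ[F] W) (Z : Finset ι)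
    (hZ : ∀ j ∈ Z, f (groupPoint g α x j) = 0) :
    ∑ h, min #{j ∈ Z | g j = h} (D h) ≤ Module.finrank F (LinearMap.ker f) := by
  classical
  have hsub : ∀ h, ∃ T ⊆ ({j ∈ Z | g j = h} : Finset ι), #T = min #{j ∈ Z | g j = h} (D h) :=
    fun h => exists_subset_card_eq (min_le_left _ _)
  choose T hTZ hTcard using hsub
  have hTg : ∀ h, ∀ j ∈ T h, j ∈ Z ∧ g j = h := fun h j hj => by simpa using hTZ h hj
  have hdisj : Set.PairwiseDisjoint (↑(univ : Finset G)) T := by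
    intro h _ h' _ hne
    refine disjoint_left.2 fun j hj hj' => hne ?_
    rw [← (hTg h j hj).2, (hTg h' j hj').2]
  have hli : LinearIndepOn F (groupPoint g α x) ((univ.biUnion T : Finset ι) : Set ι) := by
    refine linearIndepOn_groupPoint hx hα _ fun h => ?_
    refine (card_le_card ?_).trans ((hTcard h).le.trans (min_le_right _ _))
    intro j hj
    simp only [mem_filter, mem_biUnion, mem_univ, true_and] at hj
    obtain ⟨⟨h', hj'⟩, rfl⟩ := hj
    rwa [(hTg h' j hj').2]
  have hrank := (finrank_span_eq_card hli).trans (Fintype.card_coe _)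
  rw [card_biUnion hdisj, sum_congr rfl fun h _ => hTcard h] at hrank
  rw [← hrank]
  refine Submodule.finrank_mono (Submodule.span_le.2 ?_)
  rintro _ ⟨⟨j, hj⟩, rfl⟩
  obtain ⟨h, -, hj⟩ := mem_biUnion.1 hj
  exact hZ j (hTg h j hj).1

/-- Counting the zeros of a linear map among the evaluation points: the surplus over the dimension
of the kernel comes from the groups lying entirely in the kernel. -/
theorem exists_card_zeros_le [DecidableEq G] [Fintype G] {W : Type*} [AddCommGroup W] [Module F W]
    [FiniteDimensional F V] [Fintype ι] {t : ℕ} (hx : LinearIndependent F x)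
    (hα : ∀ i j, g i = g j → α i = α j → i = j) (hg : ∀ h, #{j | g j = h} = D h + t)
    (f : V →ₗ[F] W) (Z : Finset ι) (hZ : ∀ j ∈ Z, f (groupPoint g α x j) = 0) :
    ∃ S : Finset G, ∑ h ∈ S, D h ≤ Module.finrank F (LinearMap.ker f) ∧
      #Z ≤ Module.finrank F (LinearMap.ker f) + #S * t := by
  have hmin := sum_min_card_le_finrank_ker hx hα f Z hZ
  refine ⟨({h | D h ≤ #{j ∈ Z | g j = h}} : Finset G), le_trans ?_ hmin, ?_⟩
  · rw [sum_filter]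
    refine sum_le_sum fun h _ => ?_
    split_ifs with hh
    · exact le_min hh le_rfl
    · exact Nat.zero_le _
  · rw [card_eq_sum_card_fiberwise (f := g) (t := univ) (fun _ _ => mem_univ _)]
    refine le_trans ?_ (Nat.add_le_add_right hmin _)
    rw [card_filter, sum_mul, ← sum_add_distrib]
    refine sum_le_sum fun h _ => ?_
    have hle : #{j ∈ Z | g j = h} ≤ D h + t :=
      (card_le_card (filter_subset_filter _ (subset_univ Z))).trans (hg h).le
    split_ifs with hh <;> omega

/-- A linear map vanishing on as many points of a group as its dimension vanishes on the vectors
spanning that group. -/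
theorem map_eq_zero_of_groupPoint {K : Type*} [Field K] [Algebra F K]
    (hα : ∀ i j, g i = g j → α i = α j → i = j) (f : V →ₗ[F] K) (h : G) (Z : Finset ι)
    (hZg : ∀ j ∈ Z, g j = h) (hZ : ∀ j ∈ Z, f (groupPoint g α x j) = 0) (hcard : D h ≤ #Z)
    (i : Fin (D h)) : f (x ⟨h, i⟩) = 0 := by
  set P : Polynomial K := ∑ i : Fin (D h), Polynomial.monomial (i : ℕ) (f (x ⟨h, i⟩)) with hP
  have hP0 : P = 0 := by
    refine Polynomial.eq_zero_of_degree_lt_of_eval_index_eq_zero Z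
      (v := fun j => algebraMap F K (α j)) ?_ ?_ ?_
    · intro i hi j hj hij
      exact hα i j ((hZg i hi).trans (hZg j hj).symm) ((algebraMap F K).injective hij)
    · refine lt_of_lt_of_le ?_ (Nat.cast_le.2 hcard)
      refine (Polynomial.degree_sum_le _ _).trans_lt ?_
      rw [Finset.sup_lt_iff (WithBot.bot_lt_coe _)]
      intro i _
      exact (Polynomial.degree_monomial_le _ _).trans_lt (Nat.cast_lt.2 i.2)
    · intro j hj
      obtain rfl := hZg j hj
      rw [← hZ j hj, hP, Polynomial.eval_finsetSum, groupPoint, map_sum]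
      refine sum_congr rfl fun i _ => ?_
      rw [Polynomial.eval_monomial, map_smul, Algebra.smul_def, map_pow, mul_comm]
  have hc : P.coeff i = f (x ⟨h, i⟩) := by
    simp [hP, Polynomial.coeff_monomial, Fin.val_inj]
  rw [← hc, hP0, Polynomial.coeff_zero]

theorem map_groupPoint_eq_zero {W : Type*} [AddCommGroup W] [Module F W] (f : V →ₗ[F] W) {j : ι}
    (hf : ∀ i : Fin (D (g j)), f (x ⟨g j, i⟩) = 0) : f (groupPoint g α x j) = 0 := by
  simp [groupPoint, hf]

end GroupPoint

/-! ### Linearized polynomials -/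

section Linearized

variable (F : Type*) {K : Type*} [Field F] [Fintype F] [Field K] [Algebra F K]

/-- The `F`-linear map of `K` given by the linearized polynomial `∑ i, c i * X ^ (q ^ i)`, where
`q` is the cardinality of `F`. -/
noncomputable def linearizedMap (M : ℕ) : (Fin M → K) →ₗ[K] (K →ₗ[F] K) :=
  Fintype.linearCombination K fun i : Fin M =>
    ((FiniteField.frobeniusAlgHom F K) ^ (i : ℕ)).toLinearMap

theorem linearizedMap_apply {M : ℕ} (c : Fin M → K) (z : K) :
    linearizedMap F M c z = ∑ i : Fin M, c i * z ^ (Fintype.card F ^ (i : ℕ)) := by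
  have hpow : ∀ i : ℕ, ((FiniteField.frobeniusAlgHom F K) ^ i) z = z ^ (Fintype.card F ^ i) := by
    intro i
    induction i with
    | zero => simp
    | succ i ih => rw [pow_succ', AlgHom.mul_apply, ih, FiniteField.frobeniusAlgHom_apply,
        ← pow_mul, pow_succ]
  simp only [linearizedMap, Fintype.linearCombination_apply, LinearMap.sum_apply,
    LinearMap.smul_apply, AlgHom.toLinearMap_apply, hpow, smul_eq_mul]

/-- A nonzero linearized polynomial with `M` coefficients has kernel of dimension less than `M`. -/
theorem finrank_ker_linearizedMap_lt [Fintype K] {M : ℕ} {c : Fin M → K} (hc : c ≠ 0) :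
    Module.finrank F (LinearMap.ker (linearizedMap F M c)) < M := by
  classical
  obtain ⟨k, hk⟩ := Function.ne_iff.1 hc
  have hq : 1 < Fintype.card F := Fintype.one_lt_card
  set P : Polynomial K :=
    ∑ i : Fin M, Polynomial.monomial (Fintype.card F ^ (i : ℕ)) (c i) with hP
  have hP0 : P ≠ 0 := by
    intro h
    apply hk
    have hcoeff : P.coeff (Fintype.card F ^ (k : ℕ)) = c k := by
      simp [hP, Polynomial.coeff_monomial,
        Nat.pow_right_inj hq, Fin.val_inj]
    rw [← hcoeff, h]
    simp
  have hdeg : P.natDegree ≤ Fintype.card F ^ (M - 1) := by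
    refine Polynomial.natDegree_sum_le_of_forall_le _ _ fun i _ => ?_
    exact (Polynomial.natDegree_monomial_le _).trans
      (Nat.pow_le_pow_right hq.le (by have := i.2; omega))
  have hcard : Fintype.card (LinearMap.ker (linearizedMap F M c)) ≤ P.natDegree := by
    rw [← card_univ, ← card_map (Function.Embedding.subtype _)]
    refine Polynomial.card_le_degree_of_subset_roots fun z hz => ?_
    have hz' : linearizedMap F M c z = 0 := by simpa using hz
    rw [Polynomial.mem_roots hP0, Polynomial.IsRoot.def, hP, Polynomial.eval_finsetSum, ← hz',
      linearizedMap_apply]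
    simp [Polynomial.eval_monomial]
  rw [Module.card_eq_pow_finrank (K := F)] at hcard
  have := (Nat.pow_le_pow_iff_right hq).1 (hcard.trans hdeg)
  have := k.2
  omega

/-- Fewer than `M` elements are roots of a nonzero linearized polynomial with `M` coefficients. -/
theorem exists_ne_zero_linearizedMap_eq_zero {M : ℕ} {κ : Type*} [Fintype κ] (z : κ → K)
    (hκ : Fintype.card κ < M) :
    ∃ c : Fin M → K, c ≠ 0 ∧ ∀ k, linearizedMap F M c (z k) = 0 := by
  let ψ : (Fin M → K) →ₗ[K] (κ → K) :=
    LinearMap.pi fun k => LinearMap.applyₗ' K (z k) ∘ₗ linearizedMap F M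
  have hker : LinearMap.ker ψ ≠ ⊥ := LinearMap.ker_ne_bot_of_finrank_lt (by simpa using hκ)
  obtain ⟨c, hc, hc0⟩ := Submodule.exists_mem_ne_zero_of_ne_bot hker
  exact ⟨c, hc0, fun k => congrFun (LinearMap.mem_ker.1 hc) k⟩

end Linearized

/-! ### The code -/

/-- `Fin n` can be partitioned into labelled groups of prescribed sizes. -/
theorem exists_grouping {G : Type*} [Fintype G] [DecidableEq G] (E : G → ℕ) {n : ℕ}
    (hn : ∑ h, E h = n) :
    ∃ (g : Fin n → G) (p : Fin n → ℕ), (∀ h, #{j | g j = h} = E h) ∧ (∀ j, p j < E (g j)) ∧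
      ∀ i j, g i = g j → p i = p j → i = j := by
  have e : Fin n ≃ Σ h, Fin (E h) := Fintype.equivOfCardEq (by simp [hn])
  refine ⟨fun j => (e j).1, fun j => (e j).2, fun h => ?_, fun j => (e j).2.2, ?_⟩
  · have hfib : ({j | (e j).1 = h} : Finset (Fin n)) =
        univ.map ((Function.Embedding.sigmaMk h).trans e.symm.toEmbedding) := by
      ext j
      simp only [mem_filter, mem_univ, true_and, mem_map, Function.Embedding.trans_apply,
        Function.Embedding.sigmaMk_apply, Equiv.coe_toEmbedding, Equiv.symm_apply_eq]
      constructor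
      · rintro rfl
        exact ⟨(e j).2, rfl⟩
      · rintro ⟨k, hk⟩
        rw [← hk]
    rw [hfib, card_map, card_univ, Fintype.card_fin]
  · intro i j hg hp
    apply e.injective
    dsimp only at hg hp
    generalize e i = s at hg hp
    generalize e j = s' at hg hp
    obtain ⟨h, k⟩ := s
    obtain ⟨h', k'⟩ := s'
    obtain rfl : h = h' := hg
    obtain rfl : k = k' := Fin.ext hp
    rfl

theorem hammingDist_add_card_eq {ι A : Type*} [Fintype ι] [DecidableEq A] (v w : ι → A) :
    hammingDist v w + #{i | v i = w i} = Fintype.card ι := by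
  rw [hammingDist, add_comm]
  exact card_filter_add_card_filter_not _

section Code

variable {F K G : Type*} [Field F] [Fintype F] [Field K] [Fintype K] [DecidableEq K]
  [Algebra F K] {n : ℕ} {D : G → ℕ} {g : Fin n → G} {α : Fin n → F}
  {x : (Σ h, Fin (D h)) → K}

/-- The linearized-polynomial code with `M` message symbols, evaluated at the points
`groupPoint g α x`. -/
noncomputable def lrcCode (g : Fin n → G) (α : Fin n → F) (x : (Σ h, Fin (D h)) → K) (M : ℕ) :
    Finset (Fin n → K) :=
  univ.image fun (c : Fin M → K) j => linearizedMap F M c (groupPoint g α x j)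

theorem mem_lrcCode {M : ℕ} {w : Fin n → K} : w ∈ lrcCode g α x M ↔
    ∃ c : Fin M → K, (fun j => linearizedMap F M c (groupPoint g α x j)) = w := by
  simp [lrcCode]

theorem hasLocality_lrcCode [DecidableEq G] {r t M : ℕ}
    (hα : ∀ i j, g i = g j → α i = α j → i = j) (hg : ∀ h, #{j | g j = h} = D h + t)
    (hD : ∀ h, D h ≤ r) : HasLocality (↑(lrcCode g α x M) : Set (Fin n → K)) r (t + 1) := by
  intro j₀
  refine ⟨({j | g j = g j₀} : Finset (Fin n)), by simp, ?_, ?_⟩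
  · have := hD (g j₀)
    rw [hg]
    omega
  · rintro _ ⟨w, hw, rfl⟩ _ ⟨w', hw', rfl⟩ hne
    obtain ⟨c, rfl⟩ := mem_lrcCode.1 (mem_coe.1 hw)
    obtain ⟨c', rfl⟩ := mem_lrcCode.1 (mem_coe.1 hw')
    by_contra! hlt
    apply hne
    set Γ : Finset (Fin n) := {j | g j = g j₀}
    set v : Γ → K := fun j => linearizedMap F M c (groupPoint g α x j)
    set v' : Γ → K := fun j => linearizedMap F M c' (groupPoint g α x j)
    have hgΓ : ∀ j : Γ, g j = g j₀ := fun j => (mem_filter.1 j.2).2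
    have hsub : ∀ z, linearizedMap F M (c - c') z =
        linearizedMap F M c z - linearizedMap F M c' z := by simp
    have hcard := hammingDist_add_card_eq v v'
    have hΓcard : #Γ = D (g j₀) + t := hg _
    rw [Fintype.card_coe, hΓcard] at hcard
    have hzero := map_eq_zero_of_groupPoint (x := x) hα (linearizedMap F M (c - c')) (g j₀)
      ((univ.filter fun j => v j = v' j).map (Function.Embedding.subtype _))
      (fun j hj => by
        obtain ⟨k, -, rfl⟩ := mem_map.1 hj
        exact hgΓ k)
      (fun j hj => by
        obtain ⟨k, hk, rfl⟩ := mem_map.1 hj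
        rw [hsub, sub_eq_zero]
        exact (mem_filter.1 hk).2)
      (by rw [card_map]; omega)
    funext j
    refine sub_eq_zero.1 ((hsub _).symm.trans (map_groupPoint_eq_zero _ ?_))
    rw [hgΓ j]
    exact hzero

end Code

/-- The code for `a` groups of dimension `r` and one of dimension `β ≤ r`, each with redundancy
`t`, and `u * r + v` message symbols. -/
theorem exists_optimal_lrc {F K : Type*} [Field F] [Fintype F] [Field K] [Fintype K]
    [DecidableEq K] [Algebra F K] {a r β t u v n : ℕ} (hv : 1 ≤ v) (hvβ : v ≤ β) (hβr : β ≤ r)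
    (hua : u ≤ a) (hq : r + t ≤ Fintype.card F) (hrank : a * r + β ≤ Module.finrank F K)
    (hn : n = a * (r + t) + (β + t)) :
    ∃ C : Finset (Fin n → K), #C = Fintype.card K ^ (u * r + v) ∧
      HasLocality (↑C : Set (Fin n → K)) r (t + 1) ∧
      minDist (↑C : Set (Fin n → K)) + (u * r + v - 1 + u * t) = n := by
  classical
  let D : Option (Fin a) → ℕ := fun h => h.elim β fun _ => r
  have hDr : ∀ h, D h ≤ r := by
    rintro (_ | h)
    exacts [hβr, le_rfl]
  obtain ⟨g, p, hg, hp, hpinj⟩ := exists_grouping (fun h => D h + t) (n := n) (by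
    simp [D, Fintype.sum_option, hn, add_comm])
  obtain ⟨ν⟩ : Nonempty (Fin (r + t) ↪ F) :=
    Function.Embedding.nonempty_of_card_le (by simpa using hq)
  have hp' : ∀ j, p j < r + t := fun j => (hp j).trans_le (Nat.add_le_add_right (hDr _) _)
  set α : Fin n → F := fun j => ν ⟨p j, hp' j⟩
  have hα : ∀ i j, g i = g j → α i = α j → i = j := fun i j hij hαij =>
    hpinj i j hij (Fin.mk.inj_iff.1 (ν.injective hαij))
  obtain ⟨x, hx⟩ : ∃ x : (Σ h, Fin (D h)) → K, LinearIndependent F x := by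
    obtain ⟨ι⟩ : Nonempty ((Σ h, Fin (D h)) ↪ Fin (Module.finrank F K)) :=
      Function.Embedding.nonempty_of_card_le (by
        simpa [D, Fintype.sum_option, add_comm] using hrank)
    exact ⟨_, (Module.finBasis F K).linearIndependent.comp ι ι.injective⟩
  set M := u * r + v with hM
  let y := groupPoint g α x
  let enc : (Fin M → K) → Fin n → K := fun c j => linearizedMap F M c (y j)
  have hzeros : ∀ c : Fin M → K, c ≠ 0 → #{j | linearizedMap F M c (y j) = 0} ≤
      M - 1 + u * t := by
    intro c hc
    obtain ⟨S, hS, hcard⟩ := exists_card_zeros_le hx hα hg (linearizedMap F M c)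
      {j | linearizedMap F M c (y j) = 0} (fun j hj => (mem_filter.1 hj).2)
    have hker := finrank_ker_linearizedMap_lt F hc
    have hSu : #S ≤ u := by
      by_contra! hlt
      have hsum : #S * r ≤ ∑ h ∈ S, D h + (r - β) := by
        have hle : ∀ h ∈ S, r ≤ D h + if h = none then r - β else 0 := by
          rintro (_ | h) -
          · simp [D, hβr]
          · simp [D]
        have h1 := sum_le_sum hle
        rw [sum_const, smul_eq_mul, sum_add_distrib, sum_ite_eq'] at h1
        refine h1.trans (Nat.add_le_add_left ?_ _)
        split_ifs <;> omega
      have h2 : (u + 1) * r ≤ #S * r := Nat.mul_le_mul_right r hlt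
      rw [add_mul, one_mul] at h2
      omega
    have h3 : #S * t ≤ u * t := Nat.mul_le_mul_right t hSu
    omega
  have hbound : M - 1 + u * t < n := by
    have h1 : u * (r + t) ≤ a * (r + t) := Nat.mul_le_mul_right _ hua
    rw [mul_add] at h1
    omega
  have hdist : ∀ c c' : Fin M → K,
      hammingDist (enc c) (enc c') + #{j | linearizedMap F M (c - c') (y j) = 0} = n := by
    intro c c'
    have h := hammingDist_add_card_eq (enc c) (enc c')
    simpa [enc, sub_eq_zero] using h
  have hlower : ∀ c c' : Fin M → K, c ≠ c' →
      n ≤ hammingDist (enc c) (enc c') + (M - 1 + u * t) := by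
    intro c c' hne
    have h1 := hdist c c'
    have h2 := hzeros (c - c') (sub_ne_zero.2 hne)
    omega
  have hinj : Function.Injective enc := by
    intro c c' hcc
    by_contra hne
    have h1 := hlower c c' hne
    rw [hcc, hammingDist_self] at h1
    omega
  refine ⟨lrcCode g α x M, ?_, hasLocality_lrcCode hα hg hDr, ?_⟩
  · change #(univ.image enc) = _
    rw [card_image_of_injective _ hinj]
    simp
  · obtain ⟨c, hc0, hc⟩ : ∃ c : Fin M → K, c ≠ 0 ∧
        M - 1 + u * t ≤ #{j | linearizedMap F M c (y j) = 0} := by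
      let first : Finset (Option (Fin a)) := univ.map
        ((Fin.castLEEmb hua).trans Function.Embedding.some)
      obtain ⟨W, hW, hWcard⟩ := exists_subset_card_eq
        (show v - 1 ≤ #{j | g j = none} by rw [hg]; simp only [D, Option.elim]; omega)
      have hWg : ∀ j ∈ W, g j = none := fun j hj => by simpa using hW hj
      obtain ⟨c, hc0, hc⟩ := exists_ne_zero_linearizedMap_eq_zero F (M := M)
        (κ := (Fin u × Fin r) ⊕ W)
        (Sum.elim (fun k => x ⟨some (Fin.castLE hua k.1), k.2⟩) fun j => y j)
        (by simp [hWcard]; omega)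
      refine ⟨c, hc0, ?_⟩
      have hdisj : Disjoint ({j | g j ∈ first} : Finset (Fin n)) W := by
        refine disjoint_left.2 fun j hj hjW => ?_
        simp [first, hWg j hjW] at hj
      have hfirst : #({j | g j ∈ first} : Finset (Fin n)) = u * (r + t) := by
        rw [card_eq_sum_card_fiberwise (f := g) (t := first) (fun j hj => by simpa using hj),
          sum_congr rfl (g := fun _ => r + t), sum_const, card_map, card_univ, Fintype.card_fin,
          smul_eq_mul]
        intro h hh
        rw [filter_filter, filter_congr (q := fun j => g j = h), hg]
        · obtain ⟨k, -, rfl⟩ := mem_map.1 hh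
          rfl
        · intro j _
          constructor
          · exact fun h => h.2
          · rintro rfl
            exact ⟨hh, rfl⟩
      have hunion : #(({j | g j ∈ first} : Finset (Fin n)) ∪ W) = M - 1 + u * t := by
        rw [card_union_of_disjoint hdisj, hfirst, hWcard, mul_add]
        omega
      rw [← hunion]
      refine card_le_card fun j hj => mem_filter.2 ⟨mem_univ _, ?_⟩
      rcases mem_union.1 hj with hj | hj
      · refine map_groupPoint_eq_zero _ ?_
        obtain ⟨k, -, hk⟩ := mem_map.1 (mem_filter.1 hj).2
        rw [← hk]
        exact fun i => hc (Sum.inl (k, i))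
      · exact hc (Sum.inr ⟨j, hj⟩)
    have hleast : IsLeast {d | ∃ w ∈ (↑(lrcCode g α x M) : Set (Fin n → K)),
        ∃ w' ∈ (↑(lrcCode g α x M) : Set (Fin n → K)), w ≠ w' ∧ hammingDist w w' = d}
        (n - (M - 1 + u * t)) := by
      constructor
      · refine ⟨enc c, mem_lrcCode.2 ⟨c, rfl⟩, enc 0, mem_lrcCode.2 ⟨0, rfl⟩,
          hinj.ne hc0, ?_⟩
        have h1 := hdist c 0
        have h2 := hlower c 0 hc0
        rw [sub_zero] at h1
        omega
      · rintro _ ⟨w, hw, w', hw', hne, rfl⟩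
        obtain ⟨c, rfl⟩ := mem_lrcCode.1 (mem_coe.1 hw)
        obtain ⟨c', rfl⟩ := mem_lrcCode.1 (mem_coe.1 hw')
        have h1 := hlower c c' (fun h => hne (h ▸ rfl))
        exact Nat.sub_le_iff_le_add.2 h1
    rw [minDist, hleast.csInf_eq]
    omega

/-- A field with `q ^ m` elements contains a field with `q` elements. -/
theorem exists_algebra_of_card_eq_pow {K : Type} [Field K] [Fintype K] {q m : ℕ}
    (hq : IsPrimePow q) (hK : Fintype.card K = q ^ m) :
    ∃ (F : Type) (_ : Field F) (_ : Fintype F) (_ : Algebra F K),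
      Fintype.card F = q ∧ Module.finrank F K = m := by
  obtain ⟨p, k, hp, hk, rfl⟩ := (isPrimePow_nat_iff q).1 hq
  have : Fact p.Prime := ⟨hp⟩
  rw [← pow_mul] at hK
  have : CharP K p := charP_of_card_eq_prime_pow hK
  let := ZMod.algebra K p
  have hfin : Module.finrank (ZMod p) K = k * m := by
    have h := Module.card_eq_pow_finrank (K := ZMod p) (V := K)
    rw [hK, ZMod.card] at h
    exact (Nat.pow_right_injective hp.two_le h).symm
  obtain ⟨φ⟩ : Nonempty (GaloisField p k →ₐ[ZMod p] K) :=
    FiniteField.nonempty_algHom_of_finrank_dvd (by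
      rw [GaloisField.finrank p hk.ne', hfin]
      exact dvd_mul_right _ _)
  let := φ.toRingHom.toAlgebra
  let : Fintype (GaloisField p k) := Fintype.ofFinite _
  have hF : Fintype.card (GaloisField p k) = p ^ k := by
    rw [Fintype.card_eq_nat_card, GaloisField.card p k hk.ne']
  refine ⟨GaloisField p k, inferInstance, inferInstance, inferInstance, hF, ?_⟩
  have h := Module.card_eq_pow_finrank (K := GaloisField p k) (V := K)
  rw [hK, hF, ← pow_mul] at h
  exact (Nat.eq_of_mul_eq_mul_left hk (Nat.pow_right_injective hp.two_le h)).symm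

/-- **Explicit optimal scalar `(r, δ)` locally repairable codes** (Corollary 1 of
Rawat–Koyluoglu–Silberstein–Vishwanath).  Either (i) `(r+δ-1) ∣ n` and
`N = n r/(r+δ-1)`, or (ii) `(r+δ-1) ∤ n`, `β₀ = n mod (r+δ-1) - (δ-1) ≥ 1` and
`N = n - (δ-1)(⌊n/(r+δ-1)⌋ + 1)`.  Let `q ≥ r+δ-1` be a prime power, `m ≥ N`, and `K`
a finite field with `|K| = q^m`.  Then for every `𝓜` with `r ≤ 𝓜 ≤ N` (in case (ii)
additionally `0 < 𝓜 mod r ≤ β₀`) there is a scalar code `C ⊆ K^n` with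
`|C| = (q^m)^𝓜`, `(r, δ)` locality (α = 1), and minimum Hamming distance exactly
`n - 𝓜 + 1 - (⌈𝓜/r⌉ - 1)(δ - 1)`. -/
theorem scalar_lrc_optimal_construction
    (r δ n q m N : ℕ)
    (hr : 1 ≤ r) (hδ : 2 ≤ δ) (hn : r + δ - 1 < n)
    (hq : IsPrimePow q) (hqrd : r + δ - 1 ≤ q)
    (hcase : ((r + δ - 1) ∣ n ∧ N * (r + δ - 1) = n * r) ∨
             (¬ (r + δ - 1) ∣ n ∧ 1 ≤ n % (r + δ - 1) - (δ - 1) ∧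
               N = n - (δ - 1) * (n / (r + δ - 1) + 1)))
    (hm : N ≤ m)
    (K : Type) [Field K] [Fintype K] [DecidableEq K] (hK : Fintype.card K = q ^ m)
    (M : ℕ) (hM1 : r ≤ M) (hM2 : M ≤ N)
    (hMmod : ¬ (r + δ - 1) ∣ n → 0 < M % r ∧ M % r ≤ n % (r + δ - 1) - (δ - 1)) :
    ∃ C : Finset (Fin n → K),
      C.card = (q ^ m) ^ M ∧
      HasLocality (↑C : Set (Fin n → K)) r δ ∧
      (minDist (↑C : Set (Fin n → K)) : ℤ) =
        (n : ℤ) - M + 1 - (⌈(M : ℚ) / r⌉ - 1) * ((δ : ℤ) - 1) := by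
  have hs : 0 < r + δ - 1 := by omega
  obtain ⟨t, rfl⟩ : ∃ t, δ = t + 1 := ⟨δ - 1, by omega⟩
  simp only [Nat.add_sub_cancel, ← add_assoc] at *
  obtain ⟨a, β, hβ, hβr, hn', hN, hMβ⟩ : ∃ a β, 1 ≤ β ∧ β ≤ r ∧ n = a * (r + t) + (β + t) ∧
      N = a * r + β ∧ (M - 1) % r + 1 ≤ β := by
    rcases hcase with ⟨⟨b, hb⟩, hN⟩ | ⟨hdvd, hβ, hN⟩
    · obtain _ | a := b
      · omega
      · refine ⟨a, r, hr, le_rfl, by rw [hb]; ring, ?_, Nat.mod_lt _ hr⟩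
        refine Nat.eq_of_mul_eq_mul_right hs ?_
        rw [hN, hb]
        ring
    · have hdiv := Nat.div_add_mod n (r + t)
      have hlt := Nat.mod_lt n hs
      refine ⟨n / (r + t), n % (r + t) - t, hβ, by omega, ?_, ?_, ?_⟩
      · rw [mul_comm]
        omega
      · rw [hN]
        generalize n / (r + t) = b at *
        generalize n % (r + t) = k at *
        have h1 : (r + t) * b = b * r + t * b := by ring
        rw [mul_add]
        omega
      · obtain ⟨h1, h2⟩ := hMmod hdvd
        have hr1 : r ≠ 1 := by
          rintro rfl
          omega
        have h3 : (M - 1) % r + 1 = M % r := by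
          have h4 := Nat.add_mod (M - 1) 1 r
          rw [Nat.sub_add_cancel (hr.trans hM1), Nat.mod_eq_of_lt (show 1 < r by omega)] at h4
          have h5 := Nat.mod_lt (M - 1) hr
          rcases Nat.lt_or_ge ((M - 1) % r + 1) r with h6 | h6
          · rw [h4, Nat.mod_eq_of_lt h6]
          · rw [show (M - 1) % r + 1 = r by omega, Nat.mod_self] at h4
            omega
        omega
  set u := (M - 1) / r with hu
  set v := (M - 1) % r + 1 with hv
  have hMuv : M = u * r + v := by
    have := Nat.div_add_mod (M - 1) r
    rw [mul_comm, ← hu] at this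
    omega
  have hvr : v ≤ r := Nat.mod_lt _ hr
  have hua : u ≤ a := by
    by_contra! hlt
    have h1 : (a + 1) * r ≤ u * r := Nat.mul_le_mul_right r hlt
    rw [add_mul, one_mul] at h1
    omega
  obtain ⟨F, _, _, _, hF, hrank⟩ := exists_algebra_of_card_eq_pow hq hK
  obtain ⟨C, hC, hloc, hdist⟩ := exists_optimal_lrc (F := F) (K := K) (t := t) (n := n)
    (show 1 ≤ v by omega) hMβ hβr hua (by omega) (by omega) hn'
  refine ⟨C, by rw [hC, hK, hMuv], hloc, ?_⟩
  have hceil : ⌈(M : ℚ) / r⌉ = (u : ℤ) + 1 := by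
    have hr0 : (0 : ℚ) < r := by exact_mod_cast hr
    rw [Int.ceil_eq_iff, lt_div_iff₀ hr0, div_le_iff₀ hr0]
    have h1 : u * r < M := by omega
    have h2 : M ≤ (u + 1) * r := by rw [add_mul]; omega
    push_cast
    rw [add_sub_cancel_right]
    exact ⟨by exact_mod_cast h1, by exact_mod_cast h2⟩
  rw [hceil]
  have hcast : (minDist (↑C : Set (Fin n → K)) : ℤ) + (M - 1 + u * t) = n := by
    have h : minDist (↑C : Set (Fin n → K)) + (M + u * t) = n + 1 := by omega
    zify at h
    linarith
  push_cast
  linarith
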